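/- Spectral relation for Gegenbauer polynomials: for 0 < α < 1 and -1 < t < 1, ∫_{-1}^{1} C_n^{α/2}(τ) |t-τ|^{-α} (1-τ²)^{(α-1)/2} dτ = β_n(α) C_n^{α/2}(t), where β_n(α) = π(α)_n/(n! cos(πα/2)). -/

import Mathlib

open Real MeasureTheory

/-- Gegenbauer (ultraspherical) polynomial `C_n^lam` via the standard recurrence. -/
noncomputable def gegenbauer (lam : ℝ) : ℕ → ℝ → ℝ
  | 0, _ => 1
  | 1, x => 2 * lam * x
  | (n + 2), x =>
      (2 * ((n : ℝ) + 1 + lam) * x * gegenbauer lam (n + 1) x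
        - ((n : ℝ) + 2 * lam) * gegenbauer lam n x) / ((n : ℝ) + 2)


/-- Pochhammer (rising factorial) symbol `(a)_k = a(a+1)⋯(a+k-1)`. -/
noncomputable def poch (a : ℝ) (k : ℕ) : ℝ := ∏ i ∈ Finset.range k, (a + i)

open Set

theorem integral_rpow_mul_one_sub_rpow {u v : ℝ} (hu : 0 < u) (hv : 0 < v) :
    ∫ x in Ioo (0 : ℝ) 1, x ^ (u - 1) * (1 - x) ^ (v - 1) = ProbabilityTheory.beta u v := by
  rw [ProbabilityTheory.beta_eq_betaIntegralReal u v hu hv, Complex.betaIntegral,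
    intervalIntegral.integral_of_le zero_le_one, integral_Ioc_eq_integral_Ioo,
    ← RCLike.re_eq_complex_re, ← integral_re]
  · refine setIntegral_congr_fun measurableSet_Ioo fun x hx => ?_
    norm_cast
    rw [← Complex.ofReal_cpow hx.1.le, ← Complex.ofReal_cpow (by linarith [hx.2]),
      RCLike.re_eq_complex_re, Complex.re_mul_ofReal, Complex.ofReal_re]
  · exact ((intervalIntegrable_iff_integrableOn_Ioo_of_le zero_le_one).1
      (Complex.betaIntegral_convergent (by simpa) (by simpa)))

theorem integrableOn_rpow_mul_one_sub_rpow {u v : ℝ} (hu : 0 < u) (hv : 0 < v) :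
    IntegrableOn (fun x : ℝ => x ^ (u - 1) * (1 - x) ^ (v - 1)) (Ioo 0 1) := by
  refine not_imp_comm.1 integral_undef ?_
  rw [integral_rpow_mul_one_sub_rpow hu hv]
  exact (ProbabilityTheory.beta_pos hu hv).ne'

theorem beta_half_sub_half_add (α : ℝ) :
    ProbabilityTheory.beta ((1 - α) / 2) ((1 + α) / 2) = π / cos (π * α / 2) := by
  have h : (1 - α) / 2 = 1 - (1 + α) / 2 := by ring
  rw [ProbabilityTheory.beta, mul_comm (Gamma _), h, Gamma_mul_Gamma_one_sub,
    sub_add_cancel, Gamma_one, div_one, ← cos_pi_div_two_sub, ← cos_neg]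
  ring_nf

theorem beta_half_sub_add_one_half_add {α : ℝ} (h : α < 1) :
    ProbabilityTheory.beta ((1 - α) / 2 + 1) ((1 + α) / 2) =
      (1 - α) / 2 * (π / cos (π * α / 2)) := by
  have h2 : (1 - α) / 2 + (1 + α) / 2 = 1 := by ring
  have h3 : (1 - α) / 2 + 1 + (1 + α) / 2 = 2 := by ring
  rw [← beta_half_sub_half_add, ProbabilityTheory.beta, ProbabilityTheory.beta, h2, h3,
    Gamma_add_one (by linarith), Gamma_one, Gamma_two]
  ring

/-- The image of `(0, 1)` under `s ↦ s² (1 - t²) / (1 - t² s²)` is `(0, 1)`. -/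
theorem image_sq_mobius {t : ℝ} (ht1 : -1 < t) (ht2 : t < 1) :
    (fun s : ℝ => s ^ 2 * (1 - t ^ 2) / (1 - t ^ 2 * s ^ 2)) '' Ioo 0 1 = Ioo 0 1 := by
  have ht : 0 < 1 - t ^ 2 := by nlinarith
  ext x
  constructor
  · rintro ⟨s, ⟨h0, h1⟩, rfl⟩
    have hs : s ^ 2 < 1 := by nlinarith
    have hd : 0 < 1 - t ^ 2 * s ^ 2 := by nlinarith [sq_nonneg t]
    refine ⟨by positivity, ?_⟩
    simp only
    rw [div_lt_one hd]
    nlinarith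
  · rintro ⟨h0, h1⟩
    have hd : 0 < 1 - t ^ 2 + t ^ 2 * x := by positivity
    refine ⟨√(x / (1 - t ^ 2 + t ^ 2 * x)), ⟨by positivity, ?_⟩, ?_⟩
    · rw [Real.sqrt_lt' one_pos, one_pow, div_lt_one hd]
      nlinarith
    · simp only
      rw [Real.sq_sqrt (by positivity)]
      have h2 : 1 - t ^ 2 * (x / (1 - t ^ 2 + t ^ 2 * x)) =
          (1 - t ^ 2) / (1 - t ^ 2 + t ^ 2 * x) := by
        field_simp
        ring
      rw [h2]
      field_simp

theorem injOn_sq_mobius {t : ℝ} (ht1 : -1 < t) (ht2 : t < 1) :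
    InjOn (fun s : ℝ => s ^ 2 * (1 - t ^ 2) / (1 - t ^ 2 * s ^ 2)) (Ioo 0 1) := by
  have ht : 0 < 1 - t ^ 2 := by nlinarith
  intro a ⟨ha0, ha1⟩ b ⟨hb0, hb1⟩ h
  have ha : 0 < 1 - t ^ 2 * a ^ 2 := by nlinarith [sq_nonneg t, show a ^ 2 < 1 by nlinarith]
  have hb : 0 < 1 - t ^ 2 * b ^ 2 := by nlinarith [sq_nonneg t, show b ^ 2 < 1 by nlinarith]
  simp only at h
  rw [div_eq_div_iff ha.ne' hb.ne'] at h
  have : (1 - t ^ 2) * ((a + b) * (a - b)) = 0 := by linear_combination h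
  have h2 : a + b ≠ 0 := by positivity
  simp only [mul_eq_zero, ht.ne', h2, false_or] at this
  linarith

theorem hasDerivAt_sq_mobius {t s : ℝ} (hd : 1 - t ^ 2 * s ^ 2 ≠ 0) :
    HasDerivAt (fun s : ℝ => s ^ 2 * (1 - t ^ 2) / (1 - t ^ 2 * s ^ 2))
      (2 * s * (1 - t ^ 2) / (1 - t ^ 2 * s ^ 2) ^ 2) s := by
  refine ((((hasDerivAt_id s).pow 2).mul_const (1 - t ^ 2)).div
    ((((hasDerivAt_id s).pow 2).const_mul (t ^ 2)).const_sub 1) hd).congr_deriv ?_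
  simp only [id, Pi.pow_apply]
  norm_num
  ring

/-- The image of `(-1, 1)` under `s ↦ (s + t) / (1 + t s)` is `(-1, 1)`. -/
theorem image_mobius {t : ℝ} (ht1 : -1 < t) (ht2 : t < 1) :
    (fun s : ℝ => (s + t) / (1 + t * s)) '' Ioo (-1) 1 = Ioo (-1) 1 := by
  have key : ∀ r s : ℝ, r ∈ Ioo (-1 : ℝ) 1 → s ∈ Ioo (-1 : ℝ) 1 →
      0 < 1 + r * s ∧ (s + r) / (1 + r * s) ∈ Ioo (-1 : ℝ) 1 := by
    rintro r s ⟨hr1, hr2⟩ ⟨hs1, hs2⟩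
    have hd : 0 < 1 + r * s := by nlinarith
    refine ⟨hd, ?_, ?_⟩
    · rw [lt_div_iff₀ hd]; nlinarith
    · rw [div_lt_one hd]; nlinarith
  ext x
  constructor
  · rintro ⟨s, hs, rfl⟩
    exact (key t s ⟨ht1, ht2⟩ hs).2
  · intro hx
    obtain ⟨hd, hm⟩ := key (-t) x ⟨by linarith, by linarith⟩ hx
    refine ⟨_, hm, ?_⟩
    have h3 := (key t _ ⟨ht1, ht2⟩ hm).1.ne'
    simp only
    have hd' := hd.ne'
    rw [div_eq_iff h3, ← sub_eq_zero]
    generalize he : 1 + -t * x = d at *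
    field_simp
    rw [← he]
    ring

theorem injOn_mobius {t : ℝ} (ht1 : -1 < t) (ht2 : t < 1) :
    InjOn (fun s : ℝ => (s + t) / (1 + t * s)) (Ioo (-1) 1) := by
  intro a ⟨ha0, ha1⟩ b ⟨hb0, hb1⟩ h
  have ha : 0 < 1 + t * a := by nlinarith
  have hb : 0 < 1 + t * b := by nlinarith
  simp only at h
  rw [div_eq_div_iff ha.ne' hb.ne'] at h
  have : (1 - t ^ 2) * (a - b) = 0 := by linear_combination h
  have ht : 1 - t ^ 2 ≠ 0 := by nlinarith
  simp only [mul_eq_zero, ht, false_or] at this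
  linarith

theorem hasDerivAt_mobius {t s : ℝ} (hd : 1 + t * s ≠ 0) :
    HasDerivAt (fun s : ℝ => (s + t) / (1 + t * s)) ((1 - t ^ 2) / (1 + t * s) ^ 2) s := by
  refine (((hasDerivAt_id s).add_const t).div (((hasDerivAt_id s).const_mul t).const_add 1)
    hd).congr_deriv ?_
  simp only [id]
  ring

/-- The even density on `(-1, 1)` to which both the Beta density and the kernel
`|t - τ| ^ (-α) * (1 - τ ^ 2) ^ ((α - 1) / 2)` are pulled back. -/
noncomputable def pulledBackDensity (α t s : ℝ) : ℝ :=
  2 * |s| ^ (-α) * (1 - s ^ 2) ^ ((α - 1) / 2) * (1 - t ^ 2) ^ ((1 - α) / 2) /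
    (1 - t ^ 2 * s ^ 2)

theorem pulledBackDensity_neg (α t s : ℝ) :
    pulledBackDensity α t (-s) = pulledBackDensity α t s := by
  simp [pulledBackDensity]

theorem abs_deriv_smul_beta_density {α t s : ℝ} (ht1 : -1 < t) (ht2 : t < 1)
    (hs : s ∈ Ioo (0 : ℝ) 1) :
    |2 * s * (1 - t ^ 2) / (1 - t ^ 2 * s ^ 2) ^ 2| *
      ((s ^ 2 * (1 - t ^ 2) / (1 - t ^ 2 * s ^ 2)) ^ ((1 - α) / 2 - 1) *
        (1 - s ^ 2 * (1 - t ^ 2) / (1 - t ^ 2 * s ^ 2)) ^ ((1 + α) / 2 - 1)) =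
      pulledBackDensity α t s := by
  obtain ⟨hs0, hs1⟩ := hs
  have hA : 0 < 1 - t ^ 2 := by nlinarith
  have hS : 0 < 1 - s ^ 2 := by nlinarith
  have hD : 0 < 1 - t ^ 2 * s ^ 2 := by nlinarith [sq_nonneg t]
  have e : 1 - s ^ 2 * (1 - t ^ 2) / (1 - t ^ 2 * s ^ 2) =
      (1 - s ^ 2) / (1 - t ^ 2 * s ^ 2) := by
    rw [one_sub_div hD.ne']
    ring
  have e1 : (s ^ 2) ^ ((1 - α) / 2 - 1) = s ^ (-α) / s := by
    rw [← rpow_sub_one hs0.ne', ← rpow_natCast, ← rpow_mul hs0.le]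
    congr 1
    push_cast
    ring
  rw [e, pulledBackDensity, abs_of_pos hs0]
  generalize 1 - t ^ 2 * s ^ 2 = D at *
  generalize 1 - t ^ 2 = A at *
  generalize 1 - s ^ 2 = S at *
  have e2 : D ^ ((1 - α) / 2 - 1) * D ^ ((1 + α) / 2 - 1) = D⁻¹ := by
    rw [← rpow_add hD, ← rpow_neg_one]
    congr 1
    ring
  have e3 : (1 + α) / 2 - 1 = (α - 1) / 2 := by ring
  rw [e3] at e2 ⊢
  rw [abs_of_pos (by positivity), div_rpow (by positivity) hD.le, div_rpow hS.le hD.le,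
    mul_rpow (by positivity) hA.le, e1, rpow_sub_one hA.ne']
  calc _ = 2 * s ^ (-α) * A ^ ((1 - α) / 2) * S ^ ((α - 1) / 2) /
        (D ^ 2 * (D ^ ((1 - α) / 2 - 1) * D ^ ((α - 1) / 2))) := by
        field_simp
    _ = _ := by
        rw [e2]
        field_simp

theorem integrableOn_pulledBackDensity {α t : ℝ} (h0 : 0 < α) (h1 : α < 1)
    (ht1 : -1 < t) (ht2 : t < 1) : IntegrableOn (pulledBackDensity α t) (Ioo 0 1) := by
  have hd : ∀ s ∈ Ioo (0 : ℝ) 1, 1 - t ^ 2 * s ^ 2 ≠ 0 := fun s hs => by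
    nlinarith [sq_nonneg t, show s ^ 2 < 1 by nlinarith [hs.1, hs.2]]
  have h := (integrableOn_image_iff_integrableOn_abs_deriv_smul measurableSet_Ioo
    (fun s hs => (hasDerivAt_sq_mobius (hd s hs)).hasDerivWithinAt) (injOn_sq_mobius ht1 ht2)
    (fun x : ℝ => x ^ ((1 - α) / 2 - 1) * (1 - x) ^ ((1 + α) / 2 - 1))).1 (by
      rw [image_sq_mobius ht1 ht2]
      exact integrableOn_rpow_mul_one_sub_rpow (by linarith) (by linarith))
  exact h.congr_fun (fun s hs => abs_deriv_smul_beta_density ht1 ht2 hs) measurableSet_Ioo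

theorem integral_pulledBackDensity {α t : ℝ} (h0 : 0 < α) (h1 : α < 1)
    (ht1 : -1 < t) (ht2 : t < 1) :
    ∫ s in Ioo (0 : ℝ) 1, pulledBackDensity α t s = π / cos (π * α / 2) := by
  have hd : ∀ s ∈ Ioo (0 : ℝ) 1, 1 - t ^ 2 * s ^ 2 ≠ 0 := fun s hs => by
    nlinarith [sq_nonneg t, show s ^ 2 < 1 by nlinarith [hs.1, hs.2]]
  have h := integral_image_eq_integral_abs_deriv_smul measurableSet_Ioo
    (fun s hs => (hasDerivAt_sq_mobius (hd s hs)).hasDerivWithinAt) (injOn_sq_mobius ht1 ht2)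
    (fun x : ℝ => x ^ ((1 - α) / 2 - 1) * (1 - x) ^ ((1 + α) / 2 - 1))
  rw [image_sq_mobius ht1 ht2, integral_rpow_mul_one_sub_rpow (by linarith) (by linarith),
    beta_half_sub_half_add] at h
  rw [h]
  exact (setIntegral_congr_fun measurableSet_Ioo
    fun s hs => abs_deriv_smul_beta_density ht1 ht2 hs).symm

theorem integral_sq_mobius_mul_pulledBackDensity {α t : ℝ} (h0 : 0 < α) (h1 : α < 1)
    (ht1 : -1 < t) (ht2 : t < 1) :
    ∫ s in Ioo (0 : ℝ) 1, s ^ 2 * (1 - t ^ 2) / (1 - t ^ 2 * s ^ 2) * pulledBackDensity α t s =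
      (1 - α) / 2 * (π / cos (π * α / 2)) := by
  have hA : 0 < 1 - t ^ 2 := by nlinarith
  have hd : ∀ s ∈ Ioo (0 : ℝ) 1, 0 < 1 - t ^ 2 * s ^ 2 := fun s hs => by
    nlinarith [sq_nonneg t, show s ^ 2 < 1 by nlinarith [hs.1, hs.2]]
  have h := integral_image_eq_integral_abs_deriv_smul measurableSet_Ioo
    (fun s hs => (hasDerivAt_sq_mobius (hd s hs).ne').hasDerivWithinAt) (injOn_sq_mobius ht1 ht2)
    (fun x : ℝ => x ^ ((1 - α) / 2 + 1 - 1) * (1 - x) ^ ((1 + α) / 2 - 1))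
  rw [image_sq_mobius ht1 ht2, integral_rpow_mul_one_sub_rpow (by linarith) (by linarith),
    beta_half_sub_add_one_half_add h1] at h
  rw [h]
  refine setIntegral_congr_fun measurableSet_Ioo fun s hs => ?_
  have hpos : 0 < s ^ 2 * (1 - t ^ 2) / (1 - t ^ 2 * s ^ 2) :=
    div_pos (mul_pos (pow_pos hs.1 2) hA) (hd s hs)
  rw [← abs_deriv_smul_beta_density ht1 ht2 hs, add_sub_right_comm, rpow_add_one hpos.ne',
    smul_eq_mul]
  ring

theorem intervalIntegrable_mul_of_even {H m : ℝ → ℝ} (hH : IntegrableOn H (Ioo 0 1))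
    (he : ∀ s, H (-s) = H s) (hm : ContinuousOn m (Icc (-1) 1)) :
    IntervalIntegrable (fun s => m s * H s) volume (-1) 1 := by
  have hr : IntervalIntegrable H volume 0 1 :=
    (intervalIntegrable_iff_integrableOn_Ioo_of_le zero_le_one).2 hH
  have hl : IntervalIntegrable H volume (-1) 0 := by
    simpa [he] using ((IntervalIntegrable.iff_comp_neg enorm_ne_top).1 hr).symm
  exact (hl.trans hr).continuousOn_mul (by rwa [uIcc_of_le (by norm_num)])

theorem integral_mul_of_even {H m : ℝ → ℝ} (hH : IntegrableOn H (Ioo 0 1))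
    (he : ∀ s, H (-s) = H s) (hm : ContinuousOn m (Icc (-1) 1)) :
    ∫ s in (-1 : ℝ)..1, m s * H s = ∫ s in Ioo (0 : ℝ) 1, (m s + m (-s)) * H s := by
  have hi := intervalIntegrable_mul_of_even hH he hm
  have hr : IntervalIntegrable (fun s => m s * H s) volume 0 1 :=
    hi.mono_set (by simp [uIcc_of_le, Icc_subset_Icc])
  have hl : IntervalIntegrable (fun s => m s * H s) volume (-1) 0 :=
    hi.mono_set (by simp [uIcc_of_le, Icc_subset_Icc])
  have hl' : IntervalIntegrable (fun s => m (-s) * H (-s)) volume 0 1 := by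
    simpa using ((IntervalIntegrable.iff_comp_neg enorm_ne_top).1 hl).symm
  have e : ∫ s in (-1 : ℝ)..0, m s * H s = ∫ s in (0 : ℝ)..1, m (-s) * H (-s) := by
    rw [intervalIntegral.integral_comp_neg (fun s => m s * H s), neg_zero]
  rw [← intervalIntegral.integral_add_adjacent_intervals hl hr, e,
    ← intervalIntegral.integral_add hl' hr, intervalIntegral.integral_of_le zero_le_one,
    integral_Ioc_eq_integral_Ioo]
  simp only [he]
  congr 1
  ext s
  ring

theorem abs_deriv_mul_kernel {α t s : ℝ} (ht1 : -1 < t) (ht2 : t < 1)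
    (hs : s ∈ Ioo (-1 : ℝ) 1) :
    |(1 - t ^ 2) / (1 + t * s) ^ 2| *
      (|t - (s + t) / (1 + t * s)| ^ (-α) *
        (1 - ((s + t) / (1 + t * s)) ^ 2) ^ ((α - 1) / 2)) =
      (1 - t * s) / 2 * pulledBackDensity α t s := by
  obtain ⟨hs0, hs1⟩ := hs
  have hA : 0 < 1 - t ^ 2 := by nlinarith
  have hS : 0 < 1 - s ^ 2 := by nlinarith
  have hE : 0 < 1 + t * s := by nlinarith
  have hF : 0 < 1 - t * s := by nlinarith
  have e1 : t - (s + t) / (1 + t * s) = -(s * (1 - t ^ 2) / (1 + t * s)) := by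
    field_simp
    ring
  have e2 : 1 - ((s + t) / (1 + t * s)) ^ 2 = (1 - s ^ 2) * (1 - t ^ 2) / (1 + t * s) ^ 2 := by
    rw [div_pow, one_sub_div (by positivity)]
    ring
  have e3 : 1 - t ^ 2 * s ^ 2 = (1 + t * s) * (1 - t * s) := by ring
  rw [e1, e2, pulledBackDensity, e3, abs_neg, abs_div (s * _), abs_mul, abs_of_pos hA,
    abs_of_pos hE]
  generalize 1 + t * s = E at *
  generalize 1 - t * s = F at *
  generalize 1 - t ^ 2 = A at *
  generalize 1 - s ^ 2 = S at *
  have e4 : E ^ (-α) * (E ^ 2) ^ ((α - 1) / 2) = E⁻¹ := by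
    rw [← rpow_natCast, ← rpow_mul hE.le, ← rpow_add hE, ← rpow_neg_one]
    congr 1
    push_cast
    ring
  have e5 : A ^ (-α) * A ^ ((α - 1) / 2) = A ^ ((1 - α) / 2) / A := by
    rw [← rpow_add hA, ← rpow_sub_one hA.ne']
    congr 1
    ring
  rw [abs_of_pos (by positivity), div_rpow (by positivity) hE.le,
    div_rpow (by positivity) (by positivity),
    mul_rpow (by positivity) hA.le, mul_rpow hS.le hA.le]
  calc _ = |s| ^ (-α) * S ^ ((α - 1) / 2) * (A * (A ^ (-α) * A ^ ((α - 1) / 2))) /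
        (E ^ 2 * (E ^ (-α) * (E ^ 2) ^ ((α - 1) / 2))) := by
        field_simp
    _ = _ := by
        rw [e4, e5]
        field_simp

theorem intervalIntegrable_kernel {α t : ℝ} (h0 : 0 < α) (h1 : α < 1)
    (ht1 : -1 < t) (ht2 : t < 1) :
    IntervalIntegrable (fun τ => |t - τ| ^ (-α) * (1 - τ ^ 2) ^ ((α - 1) / 2))
      volume (-1) 1 := by
  have hd : ∀ s ∈ Ioo (-1 : ℝ) 1, 1 + t * s ≠ 0 := fun s hs => by nlinarith [hs.1, hs.2]
  rw [intervalIntegrable_iff_integrableOn_Ioo_of_le (by norm_num), ← image_mobius ht1 ht2,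
    integrableOn_image_iff_integrableOn_abs_deriv_smul measurableSet_Ioo
      (fun s hs => (hasDerivAt_mobius (hd s hs)).hasDerivWithinAt) (injOn_mobius ht1 ht2)]
  refine IntegrableOn.congr_fun ?_ (fun s hs => (abs_deriv_mul_kernel ht1 ht2 hs).symm)
    measurableSet_Ioo
  rw [← intervalIntegrable_iff_integrableOn_Ioo_of_le (by norm_num)]
  exact intervalIntegrable_mul_of_even (integrableOn_pulledBackDensity h0 h1 ht1 ht2)
    (pulledBackDensity_neg α t) (by fun_prop)

theorem integral_mul_kernel_eq_mobius {α t : ℝ} (ht1 : -1 < t) (ht2 : t < 1) (f : ℝ → ℝ) :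
    ∫ τ in (-1 : ℝ)..1, f τ * (|t - τ| ^ (-α) * (1 - τ ^ 2) ^ ((α - 1) / 2)) =
      ∫ s in (-1 : ℝ)..1,
        f ((s + t) / (1 + t * s)) * ((1 - t * s) / 2) * pulledBackDensity α t s := by
  have hd : ∀ s ∈ Ioo (-1 : ℝ) 1, 1 + t * s ≠ 0 := fun s hs => by nlinarith [hs.1, hs.2]
  rw [intervalIntegral.integral_of_le (by norm_num), integral_Ioc_eq_integral_Ioo,
    intervalIntegral.integral_of_le (by norm_num), integral_Ioc_eq_integral_Ioo]
  conv_lhs => rw [← image_mobius ht1 ht2]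
  rw [integral_image_eq_integral_abs_deriv_smul measurableSet_Ioo
      (fun s hs => (hasDerivAt_mobius (hd s hs)).hasDerivWithinAt) (injOn_mobius ht1 ht2)]
  refine setIntegral_congr_fun measurableSet_Ioo fun s hs => ?_
  simp only [smul_eq_mul]
  rw [mul_assoc (f _), ← abs_deriv_mul_kernel ht1 ht2 hs]
  ring

theorem integral_kernel {α t : ℝ} (h0 : 0 < α) (h1 : α < 1) (ht1 : -1 < t) (ht2 : t < 1) :
    ∫ τ in (-1 : ℝ)..1, |t - τ| ^ (-α) * (1 - τ ^ 2) ^ ((α - 1) / 2) = π / cos (π * α / 2) := by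
  have h := integral_mul_kernel_eq_mobius (α := α) ht1 ht2 (fun _ => 1)
  simp only [one_mul] at h
  rw [h, integral_mul_of_even (integrableOn_pulledBackDensity h0 h1 ht1 ht2)
    (pulledBackDensity_neg α t) (by fun_prop), ← integral_pulledBackDensity h0 h1 ht1 ht2]
  congr 1
  ext s
  ring

theorem integral_sub_mul_kernel {α t : ℝ} (h0 : 0 < α) (h1 : α < 1)
    (ht1 : -1 < t) (ht2 : t < 1) :
    ∫ τ in (-1 : ℝ)..1, (τ - t) * (|t - τ| ^ (-α) * (1 - τ ^ 2) ^ ((α - 1) / 2)) =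
      -(1 - α) * t * (π / cos (π * α / 2)) := by
  have hd : ∀ s ∈ Icc (-1 : ℝ) 1, 1 + t * s ≠ 0 := fun s hs => by
    have h := abs_mul t s
    have h2 : |t| * |s| ≤ |t| := mul_le_of_le_one_right (abs_nonneg t) (abs_le.2 hs)
    linarith [abs_lt.2 ⟨ht1, ht2⟩, neg_abs_le (t * s)]
  rw [integral_mul_kernel_eq_mobius ht1 ht2 (fun τ => τ - t),
    integral_mul_of_even (m := fun s => ((s + t) / (1 + t * s) - t) * ((1 - t * s) / 2))
      (integrableOn_pulledBackDensity h0 h1 ht1 ht2)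
      (pulledBackDensity_neg α t) (by fun_prop (disch := assumption))]
  have e : -(1 - α) * t * (π / cos (π * α / 2)) =
    -2 * t * ((1 - α) / 2 * (π / cos (π * α / 2))) := by ring
  rw [e, ← integral_sq_mobius_mul_pulledBackDensity h0 h1 ht1 ht2, ← integral_const_mul]
  refine setIntegral_congr_fun measurableSet_Ioo fun s hs => ?_
  have hE : 1 + t * s ≠ 0 := by nlinarith [hs.1, hs.2]
  have hF : 1 - t * s ≠ 0 := by nlinarith [hs.1, hs.2]
  have e3 : 1 - t ^ 2 * s ^ 2 = (1 + t * s) * (1 - t * s) := by ring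
  rw [← mul_assoc, e3]
  congr 1
  rw [mul_neg, ← sub_eq_add_neg]
  generalize hE' : 1 + t * s = E at *
  generalize hF' : 1 - t * s = F at *
  rw [sub_neg_eq_add, hE']
  field_simp
  rw [← hE', ← hF']
  ring

theorem gegenbauer_zero (lam x : ℝ) : gegenbauer lam 0 x = 1 := by
  simp only [gegenbauer]

theorem gegenbauer_one (lam x : ℝ) : gegenbauer lam 1 x = 2 * lam * x := by
  simp only [gegenbauer]

theorem gegenbauer_add_two (lam : ℝ) (n : ℕ) (x : ℝ) :
    gegenbauer lam (n + 2) x = (2 * ((n : ℝ) + 1 + lam) * x * gegenbauer lam (n + 1) x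
        - ((n : ℝ) + 2 * lam) * gegenbauer lam n x) / ((n : ℝ) + 2) := by
  rw [gegenbauer]

theorem contDiff_gegenbauer (lam : ℝ) (n : ℕ) : ContDiff ℝ 2 (gegenbauer lam n) := by
  induction n using Nat.twoStepInduction with
  | zero => simpa only [funext (gegenbauer_zero lam)] using contDiff_const
  | one =>
    rw [funext (gegenbauer_one lam)]
    fun_prop
  | more n h0 h1 =>
    rw [funext (gegenbauer_add_two lam n)]
    fun_prop

theorem hasDerivAt_gegenbauer (lam : ℝ) (n : ℕ) (x : ℝ) :
    HasDerivAt (gegenbauer lam n) (deriv (gegenbauer lam n) x) x :=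
  ((contDiff_gegenbauer lam n).differentiable two_ne_zero x).hasDerivAt

theorem contDiff_deriv_gegenbauer (lam : ℝ) (n : ℕ) :
    ContDiff ℝ 1 (deriv (gegenbauer lam n)) :=
  ContDiff.deriv' (contDiff_gegenbauer lam n)

theorem deriv_gegenbauer_add_two (lam : ℝ) (n : ℕ) (x : ℝ) :
    deriv (gegenbauer lam (n + 2)) x =
      (2 * ((n : ℝ) + 1 + lam) *
          (gegenbauer lam (n + 1) x + x * deriv (gegenbauer lam (n + 1)) x)
        - ((n : ℝ) + 2 * lam) * deriv (gegenbauer lam n) x) / ((n : ℝ) + 2) := by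
  rw [funext (gegenbauer_add_two lam n)]
  refine HasDerivAt.deriv ?_
  refine ((((((hasDerivAt_id x).const_mul (2 * ((n : ℝ) + 1 + lam))).mul
    (hasDerivAt_gegenbauer lam (n + 1) x)).sub
    ((hasDerivAt_gegenbauer lam n x).const_mul _)).div_const _)).congr_deriv ?_
  simp only [id]
  ring

theorem one_sub_sq_mul_deriv_gegenbauer (lam : ℝ) (n : ℕ) (x : ℝ) :
    (1 - x ^ 2) * deriv (gegenbauer lam n) x =
      (n + 2 * lam) * x * gegenbauer lam n x - (n + 1) * gegenbauer lam (n + 1) x := by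
  induction n using Nat.twoStepInduction with
  | zero =>
    rw [funext (gegenbauer_zero lam), gegenbauer_one]
    simp
  | one =>
    rw [funext (gegenbauer_one lam), gegenbauer_add_two, gegenbauer_zero, gegenbauer_one,
      deriv_const_mul_field', deriv_id'']
    push_cast
    ring
  | more n h0 h1 =>
    rw [deriv_gegenbauer_add_two, mul_div_assoc', mul_sub, mul_left_comm (1 - x ^ 2),
      mul_left_comm (1 - x ^ 2), h0, mul_add (1 - x ^ 2), mul_left_comm (1 - x ^ 2) x, h1,
      gegenbauer_add_two lam (n + 1)]
    simp only [show n + 1 + 1 = n + 2 from rfl]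
    rw [gegenbauer_add_two lam n]
    push_cast
    have h2 : (n : ℝ) + 2 ≠ 0 := by positivity
    have h3 : (n : ℝ) + 1 + 2 ≠ 0 := by positivity
    field_simp
    ring

/-- The Gegenbauer differential equation. -/
theorem one_sub_sq_mul_deriv_deriv_gegenbauer (lam : ℝ) (n : ℕ) {x : ℝ} (hx : 1 - x ^ 2 ≠ 0) :
    (1 - x ^ 2) * deriv (deriv (gegenbauer lam n)) x =
      (2 * lam + 1) * x * deriv (gegenbauer lam n) x - n * (n + 2 * lam) * gegenbauer lam n x := by
  have hq := ((contDiff_deriv_gegenbauer lam n).differentiable one_ne_zero x).hasDerivAt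
  have hl := (((hasDerivAt_id x).pow 2).const_sub 1).mul hq
  have hr := (((hasDerivAt_id x).const_mul ((n : ℝ) + 2 * lam)).mul
    (hasDerivAt_gegenbauer lam n x)).sub
    ((hasDerivAt_gegenbauer lam (n + 1) x).const_mul ((n : ℝ) + 1))
  have he : HasDerivAt _ _ x := hl.congr_of_eventuallyEq (f₁ := fun x =>
    (n + 2 * lam) * x * gegenbauer lam n x - (n + 1) * gegenbauer lam (n + 1) x)
    (Filter.Eventually.of_forall fun y => (one_sub_sq_mul_deriv_gegenbauer lam n y).symm)
  have h := he.unique hr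
  simp only [id, Pi.pow_apply] at h
  norm_num at h
  have e0 := one_sub_sq_mul_deriv_gegenbauer lam n x
  have e1 := one_sub_sq_mul_deriv_gegenbauer lam (n + 1) x
  have h2 : (n : ℝ) + 2 ≠ 0 := by positivity
  rw [gegenbauer_add_two] at e1
  push_cast at e1
  have e1' : (1 - x ^ 2) * deriv (gegenbauer lam (n + 1)) x =
      (n + 2 * lam) * gegenbauer lam n x - (n + 1) * x * gegenbauer lam (n + 1) x := by
    rw [e1]
    field_simp
    ring
  refine mul_left_cancel₀ hx ?_
  linear_combination (1 - x ^ 2) * h + (n + 1) * x * e0 - (n + 1) * e1'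

theorem continuous_mul_abs_rpow_neg {α : ℝ} (h1 : α < 1) :
    Continuous fun u : ℝ => u * |u| ^ (-α) := by
  have h : (fun u : ℝ => u * |u| ^ (-α)) =
      fun u => (max u 0) ^ (1 - α) - (max (-u) 0) ^ (1 - α) := by
    ext u
    have h0 : (0 : ℝ) ^ (1 - α) = 0 := zero_rpow (by linarith)
    rcases lt_trichotomy u 0 with hu | rfl | hu
    · rw [max_eq_right hu.le, max_eq_left (by linarith), h0, abs_of_neg hu, sub_eq_neg_add (1 : ℝ),
        rpow_add_one (by linarith)]
      ring
    · simp
    · rw [max_eq_left hu.le, max_eq_right (by linarith), h0, abs_of_pos hu, sub_eq_neg_add (1 : ℝ),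
        rpow_add_one (by linarith)]
      ring
  rw [h]
  exact ((continuous_id.max continuous_const).rpow_const fun _ => Or.inr (by linarith)).sub
    ((continuous_neg.max continuous_const).rpow_const fun _ => Or.inr (by linarith))

theorem hasDerivAt_mul_abs_rpow_neg (α : ℝ) {u : ℝ} (hu : u ≠ 0) :
    HasDerivAt (fun u : ℝ => u * |u| ^ (-α)) ((1 - α) * |u| ^ (-α)) u := by
  have hu' := abs_ne_zero.2 hu
  refine ((hasDerivAt_id u).mul ((hasDerivAt_abs hu).rpow_const (p := -α)
    (Or.inl hu'))).congr_deriv ?_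
  rw [rpow_sub_one hu']
  have h : u * SignType.sign u = |u| := self_mul_sign u
  simp only [id]
  field_simp
  linear_combination -α * h

/-- The integrand is the derivative of
`(τ - t) |τ - t| ^ (-α) (1 - τ²) ^ ((α + 1) / 2) (d C_n / dτ)`, which vanishes at `±1`. -/
theorem integral_deriv_gegenbauer_kernel {α t : ℝ} (h0 : 0 < α) (h1 : α < 1)
    (ht1 : -1 < t) (ht2 : t < 1) (n : ℕ) :
    ∫ τ in (-1 : ℝ)..1, ((1 - α) * ((1 - τ ^ 2) * deriv (gegenbauer (α / 2) n) τ) -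
        n * (n + α) * (τ - t) * gegenbauer (α / 2) n τ) *
      (|t - τ| ^ (-α) * (1 - τ ^ 2) ^ ((α - 1) / 2)) = 0 := by
  have hq := (contDiff_deriv_gegenbauer (α / 2) n)
  have hqc := hq.continuous
  have hc := (contDiff_gegenbauer (α / 2) n).continuous
  rw [integral_eq_of_hasDerivAt_off_countable_of_le
    (fun τ => (τ - t) * |τ - t| ^ (-α) *
      ((1 - τ ^ 2) ^ ((α + 1) / 2) * deriv (gegenbauer (α / 2) n) τ)) _ (by norm_num)
    (countable_singleton t) _ _
    ((intervalIntegrable_kernel h0 h1 ht1 ht2).continuousOn_mul (by fun_prop))]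
  · have : (α + 1) / 2 ≠ 0 := by positivity
    simp [zero_rpow this]
  · refine Continuous.continuousOn ?_
    refine ((continuous_mul_abs_rpow_neg h1).comp (continuous_id.sub continuous_const)).mul
      (Continuous.mul ?_ hqc)
    exact Continuous.rpow_const (by fun_prop) fun _ => Or.inr (by positivity)
  · rintro τ ⟨⟨hτ1, hτ2⟩, hτ⟩
    have hw : 0 < 1 - τ ^ 2 := by nlinarith
    have hd := ((hasDerivAt_mul_abs_rpow_neg α (sub_ne_zero.2 hτ)).comp τ
      ((hasDerivAt_id τ).sub_const t)).mul
      (((((hasDerivAt_id τ).pow 2).const_sub 1).rpow_const (p := (α + 1) / 2) (Or.inl hw.ne')).mul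
        (hq.differentiable one_ne_zero τ).hasDerivAt)
    refine hd.congr_deriv ?_
    have hode := one_sub_sq_mul_deriv_deriv_gegenbauer (α / 2) n hw.ne'
    have e1 : (1 - τ ^ 2) ^ ((α + 1) / 2) = (1 - τ ^ 2) ^ ((α - 1) / 2) * (1 - τ ^ 2) := by
      rw [← rpow_add_one hw.ne']
      congr 1
      ring
    have e2 : (α + 1) / 2 - 1 = (α - 1) / 2 := by ring
    simp only [id, Pi.pow_apply, Function.comp, e1, e2, abs_sub_comm t τ]
    norm_num
    linear_combination
      ((τ - t) * |τ - t| ^ (-α) * (1 - τ ^ 2) ^ ((α - 1) / 2)) * hode +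
        (1 - α) * |τ - t| ^ (-α) * deriv (gegenbauer (α / 2) n) τ * e1

theorem intervalIntegrable_gegenbauer_mul_kernel {α t : ℝ} (h0 : 0 < α) (h1 : α < 1)
    (ht1 : -1 < t) (ht2 : t < 1) (n : ℕ) :
    IntervalIntegrable (fun τ => gegenbauer (α / 2) n τ *
      (|t - τ| ^ (-α) * (1 - τ ^ 2) ^ ((α - 1) / 2))) volume (-1) 1 :=
  (intervalIntegrable_kernel h0 h1 ht1 ht2).continuousOn_mul
    (contDiff_gegenbauer (α / 2) n).continuous.continuousOn

/-- Three-term recurrence in `n` for the integrals of `C_n` against the kernel. -/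
theorem integral_gegenbauer_mul_kernel_add_two {α t : ℝ} (h0 : 0 < α) (h1 : α < 1)
    (ht1 : -1 < t) (ht2 : t < 1) (n : ℕ) {I : ℕ → ℝ}
    (hI : ∀ n, I n = ∫ τ in (-1 : ℝ)..1, gegenbauer (α / 2) n τ *
      (|t - τ| ^ (-α) * (1 - τ ^ 2) ^ ((α - 1) / 2))) :
    (n + 1) * (n + 2) ^ 2 * I (n + 2) =
      t * (n + 1) * (n + 1 + α) * (2 * n + 2 + α) * I (n + 1) -
        (n + 1 + α) * (n + α) ^ 2 * I n := by
  have hint := intervalIntegrable_gegenbauer_mul_kernel h0 h1 ht1 ht2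
  have h := integral_deriv_gegenbauer_kernel h0 h1 ht1 ht2 (n + 1)
  replace h := congrArg (fun y => (2 * n + 2 + α) * y) h
  simp only [mul_zero] at h
  rw [← intervalIntegral.integral_const_mul] at h
  rw [hI n, hI (n + 1), hI (n + 2), eq_comm, ← sub_eq_zero, ← h,
    ← intervalIntegral.integral_const_mul, ← intervalIntegral.integral_const_mul,
    ← intervalIntegral.integral_const_mul,
    ← intervalIntegral.integral_sub ((hint _).const_mul _) ((hint _).const_mul _),
    ← intervalIntegral.integral_sub
      (((hint _).const_mul _).sub ((hint _).const_mul _)) ((hint _).const_mul _)]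
  congr 1
  ext τ
  rw [one_sub_sq_mul_deriv_gegenbauer]
  simp only [show n + 1 + 1 = n + 2 from rfl]
  rw [gegenbauer_add_two]
  have h2 : (n : ℝ) + 2 ≠ 0 := by positivity
  push_cast
  field_simp
  ring

theorem poch_succ (a : ℝ) (n : ℕ) : poch a (n + 1) = poch a n * (a + n) :=
  Finset.prod_range_succ _ n

theorem stmt10 (α : ℝ) (h0 : 0 < α) (h1 : α < 1) (n : ℕ) (t : ℝ)
    (ht1 : -1 < t) (ht2 : t < 1) :
    (∫ τ in (-1 : ℝ)..1,
        gegenbauer (α / 2) n τ * |t - τ| ^ (-α) * (1 - τ ^ 2) ^ ((α - 1) / 2)) =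
      (π * poch α n / ((n.factorial : ℝ) * Real.cos (π * α / 2))) *
        gegenbauer (α / 2) n t := by
  simp only [mul_assoc (gegenbauer _ _ _)]
  have hcos : 0 < cos (π * α / 2) :=
    cos_pos_of_mem_Ioo ⟨by nlinarith [pi_pos], by nlinarith [pi_pos]⟩
  have hK := intervalIntegrable_kernel h0 h1 ht1 ht2
  induction n using Nat.twoStepInduction with
  | zero => simp [gegenbauer_zero, poch, integral_kernel h0 h1 ht1 ht2]
  | one =>
    have e : ∀ τ, gegenbauer (α / 2) 1 τ * (|t - τ| ^ (-α) * (1 - τ ^ 2) ^ ((α - 1) / 2)) =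
        α * ((τ - t) * (|t - τ| ^ (-α) * (1 - τ ^ 2) ^ ((α - 1) / 2))) +
          α * t * (|t - τ| ^ (-α) * (1 - τ ^ 2) ^ ((α - 1) / 2)) := fun τ => by
      rw [gegenbauer_one]
      ring
    simp only [e]
    rw [intervalIntegral.integral_add ((hK.continuousOn_mul (by fun_prop)).const_mul α)
      (hK.const_mul _), intervalIntegral.integral_const_mul, intervalIntegral.integral_const_mul,
      integral_kernel h0 h1 ht1 ht2, integral_sub_mul_kernel h0 h1 ht1 ht2, gegenbauer_one]
    simp [poch]
    field_simp
    ring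
  | more n ih0 ih1 =>
    have h := integral_gegenbauer_mul_kernel_add_two h0 h1 ht1 ht2 n (fun _ => rfl)
    rw [ih0, ih1] at h
    refine mul_left_cancel₀ (show ((n : ℝ) + 1) * (n + 2) ^ 2 ≠ 0 by positivity) ?_
    rw [h, gegenbauer_add_two, poch_succ α (n + 1), poch_succ, Nat.factorial_succ (n + 1),
      Nat.factorial_succ]
    push_cast
    generalize cos (π * α / 2) = c at *
    have hf : (n.factorial : ℝ) ≠ 0 := by positivity
    have h2 : (n : ℝ) + 1 + 1 ≠ 0 := by positivity
    field_simp
    ring
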